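/- arXiv:2408.06311 — 2 statements merged into one kernel-verified Lean document; each statement's English description precedes it below -/
import Mathlib

section
/- Let X be a real m×n matrix of full column rank, R an invertible real n×n matrix, s > 0 a real number, and E a real n×n matrix such that RᵀR = XᵀX + sI + E and ‖E‖₂ ≤ 0.1·s. Then σ_n(XR⁻¹) ≥ 0.9·σ_n(X)/√(σ_n(X)² + s), where σ_n denotes the smallest singular value. -/
open scoped BigOperators
open Matrix

/-- `[M]_g`: the largest Euclidean (2-)norm among the columns of `M`. -/
noncomputable def gNorm {m n : ℕ} (M : Matrix (Fin m) (Fin n) ℝ) : ℝ :=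
  ⨆ j : Fin n, Real.sqrt (∑ i, M i j ^ 2)

/-- Spectral norm (largest singular value) of a real matrix. -/
noncomputable def matrixSpectralNorm {m n : ℕ} (A : Matrix (Fin m) (Fin n) ℝ) : ℝ :=
  ‖LinearMap.toContinuousLinearMap (Matrix.toEuclideanLin A)‖

/-- Frobenius norm of a real matrix. -/
noncomputable def frobeniusNorm {m n : ℕ} (A : Matrix (Fin m) (Fin n) ℝ) : ℝ :=
  Real.sqrt (∑ i, ∑ j, A i j ^ 2)

/-- Smallest singular value `σ_n(X)` of a real `m × n` matrix. -/
noncomputable def sigmaMin {m n : ℕ} (X : Matrix (Fin m) (Fin n) ℝ) : ℝ :=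
  ⨅ v : { v : EuclideanSpace ℝ (Fin n) // ‖v‖ = 1 },
    ‖(Matrix.toEuclideanLin X) v.1‖

lemma aux_norm_sq {m n : ℕ} (A : Matrix (Fin m) (Fin n) ℝ) (w : EuclideanSpace ℝ (Fin n)) :
    ‖Matrix.toEuclideanLin A w‖ ^ 2 = w.ofLp ⬝ᵥ ((Aᵀ * A) *ᵥ w.ofLp) := by
  rw [EuclideanSpace.norm_sq_eq, ← Matrix.mulVec_mulVec, Matrix.dotProduct_mulVec,
    Matrix.vecMul_transpose]
  simp [dotProduct, sq, Matrix.toLpLin_apply]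

lemma aux_E {n : ℕ} (E : Matrix (Fin n) (Fin n) ℝ) (w : EuclideanSpace ℝ (Fin n)) :
    w.ofLp ⬝ᵥ (E *ᵥ w.ofLp) ≤ matrixSpectralNorm E * ‖w‖ ^ 2 := by
  have h1 : w.ofLp ⬝ᵥ (E *ᵥ w.ofLp) = inner ℝ w (Matrix.toEuclideanLin E w) := by
    simp [PiLp.inner_apply, dotProduct, Matrix.toLpLin_apply, mul_comm]
  have h2 := real_inner_le_norm w (Matrix.toEuclideanLin E w)
  have h3 := (LinearMap.toContinuousLinearMap (Matrix.toEuclideanLin E)).le_opNorm w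
  rw [h1]
  unfold matrixSpectralNorm
  have h4 := mul_le_mul_of_nonneg_left h3 (norm_nonneg w)
  simp only [LinearMap.coe_toContinuousLinearMap'] at h4
  nlinarith

lemma aux_sigma {m n : ℕ} (X : Matrix (Fin m) (Fin n) ℝ) (w : EuclideanSpace ℝ (Fin n)) :
    sigmaMin X * ‖w‖ ≤ ‖Matrix.toEuclideanLin X w‖ := by
  by_cases hw : w = 0
  · simp [hw]
  have hw' : 0 < ‖w‖ := norm_pos_iff.mpr hw
  have hu : ‖(‖w‖⁻¹ • w)‖ = 1 := by
    rw [norm_smul, norm_inv, norm_norm, inv_mul_cancel₀ hw'.ne']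
  have hb : BddBelow (Set.range fun v : { v : EuclideanSpace ℝ (Fin n) // ‖v‖ = 1 } =>
      ‖(Matrix.toEuclideanLin X) v.1‖) :=
    ⟨0, by rintro _ ⟨v, rfl⟩; exact norm_nonneg _⟩
  have h1 : sigmaMin X ≤ ‖Matrix.toEuclideanLin X (‖w‖⁻¹ • w)‖ :=
    ciInf_le hb ⟨‖w‖⁻¹ • w, hu⟩
  rw [map_smul, norm_smul, norm_inv, norm_norm, inv_mul_eq_div, le_div_iff₀ hw'] at h1
  exact h1

lemma aux_nonneg {m n : ℕ} (X : Matrix (Fin m) (Fin n) ℝ) : 0 ≤ sigmaMin X :=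
  Real.iInf_nonneg fun _ => norm_nonneg _

theorem sigmaMin_XRinv_ge {m n : ℕ} (X : Matrix (Fin m) (Fin n) ℝ)
    (hrank : X.rank = n)
    (R : Matrix (Fin n) (Fin n) ℝ) (hR : IsUnit R.det)
    (s : ℝ) (hs : 0 < s) (E : Matrix (Fin n) (Fin n) ℝ)
    (hE : matrixSpectralNorm E ≤ 0.1 * s)
    (h : Rᵀ * R = Xᵀ * X + s • (1 : Matrix (Fin n) (Fin n) ℝ) + E) :
    sigmaMin (X * R⁻¹) ≥ 0.9 * sigmaMin X / Real.sqrt (sigmaMin X ^ 2 + s) := by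
  rcases isEmpty_or_nonempty { v : EuclideanSpace ℝ (Fin n) // ‖v‖ = 1 } with he | he
  · have h0 : sigmaMin X = 0 := by unfold sigmaMin; exact Real.iInf_of_isEmpty _
    rw [h0]
    simpa using aux_nonneg (X * R⁻¹)
  refine le_ciInf fun v => ?_
  obtain ⟨v, hv⟩ := v
  have hσ := aux_nonneg X
  obtain ⟨w, hw⟩ : ∃ w, w = Matrix.toEuclideanLin R⁻¹ v := ⟨_, rfl⟩
  have hX : Matrix.toEuclideanLin (X * R⁻¹) v = Matrix.toEuclideanLin X w := by
    rw [hw]; simp [Matrix.toLpLin_apply, Matrix.mulVec_mulVec]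
  have hRw : Matrix.toEuclideanLin R w = v := by
    rw [hw]; simp [Matrix.toLpLin_apply, Matrix.mulVec_mulVec, Matrix.mul_nonsing_inv R hR]
  have h1 := aux_norm_sq R w
  have hww : w.ofLp ⬝ᵥ w.ofLp = ‖w‖ ^ 2 := by
    rw [EuclideanSpace.norm_sq_eq]; simp [dotProduct, sq]
  rw [hRw, hv, h, Matrix.add_mulVec, Matrix.add_mulVec, dotProduct_add, dotProduct_add,
    ← aux_norm_sq, Matrix.smul_mulVec, Matrix.one_mulVec, dotProduct_smul, hww, smul_eq_mul] at h1
  have h2 := aux_E E w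
  have h3 := mul_le_mul_of_nonneg_right hE (sq_nonneg ‖w‖)
  have h4 := aux_sigma X w
  change _ ≤ ‖Matrix.toEuclideanLin (X * R⁻¹) v‖
  rw [hX]
  generalize sigmaMin X = σ at *
  have ht := norm_nonneg (Matrix.toEuclideanLin X w)
  generalize ‖Matrix.toEuclideanLin X w‖ = t at *
  have hwn := norm_nonneg w
  generalize ‖w‖ = r at *
  have h5 : (σ * r) ^ 2 ≤ t ^ 2 := pow_le_pow_left₀ (by positivity) h4 2
  have h6 : 1 ≤ t ^ 2 + 1.1 * s * r ^ 2 := by nlinarith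
  have h7 : σ ^ 2 ≤ (σ ^ 2 + 1.1 * s) * t ^ 2 := by
    have := mul_le_mul_of_nonneg_left h6 (sq_nonneg σ)
    have := mul_le_mul_of_nonneg_left h5 hs.le
    nlinarith
  have hp : 0 < σ ^ 2 + s := by positivity
  rw [div_le_iff₀ (Real.sqrt_pos.mpr hp)]
  refine (sq_le_sq₀ (by positivity) (by positivity)).mp ?_
  rw [mul_pow, mul_pow, Real.sq_sqrt hp.le]
  nlinarith [mul_nonneg (sq_nonneg σ) (sq_nonneg t), mul_nonneg hs.le (sq_nonneg t)]
end

section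
/- Let X, Q, Q₁, Q₂ be real m×n matrices and R, R₁, R₂, R₃, R₄, E₃, E₄, E₇, E₈ real n×n matrices satisfying Q₁R₁ = Q + E₃, R₁R − R₂ = E₄, Q₂R₃ = Q₁ + E₇, and R₃R₂ − R₄ = E₈. Then ‖Q₂R₄ − X‖_F ≤ ‖QR − X‖_F + ‖E₃‖_F‖R‖₂ + ‖Q₁‖₂‖E₄‖_F + ‖E₇‖_F‖R₂‖₂ + ‖Q₂‖₂‖E₈‖_F. -/
open scoped BigOperators
open Matrix

open scoped Matrix.Norms.L2Operator in
theorem aux_spec_eq {m n : ℕ} (A : Matrix (Fin m) (Fin n) ℝ) :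
    matrixSpectralNorm A = ‖A‖ := rfl

theorem aux_spec_transpose {m n : ℕ} (A : Matrix (Fin m) (Fin n) ℝ) :
    matrixSpectralNorm Aᵀ = matrixSpectralNorm A := by
  rw [aux_spec_eq, aux_spec_eq, ← Matrix.l2_opNorm_conjTranspose A,
    Matrix.conjTranspose_eq_transpose_of_trivial]

theorem aux_frob_transpose {m n : ℕ} (A : Matrix (Fin m) (Fin n) ℝ) :
    frobeniusNorm Aᵀ = frobeniusNorm A := by
  unfold frobeniusNorm
  rw [Finset.sum_comm]
  rfl

open scoped Matrix.Norms.Frobenius in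
theorem aux_frob_eq {m n : ℕ} (A : Matrix (Fin m) (Fin n) ℝ) :
    frobeniusNorm A = ‖A‖ := by
  rw [Matrix.frobenius_norm_def, frobeniusNorm, Real.sqrt_eq_rpow]
  simp

open scoped Matrix.Norms.Frobenius in
theorem aux_frob_add {m n : ℕ} (A B : Matrix (Fin m) (Fin n) ℝ) :
    frobeniusNorm (A + B) ≤ frobeniusNorm A + frobeniusNorm B := by
  simp only [aux_frob_eq]
  exact norm_add_le A B

open scoped Matrix.Norms.Frobenius in
theorem aux_frob_sub {m n : ℕ} (A B : Matrix (Fin m) (Fin n) ℝ) :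
    frobeniusNorm (A - B) ≤ frobeniusNorm A + frobeniusNorm B := by
  simp only [aux_frob_eq]
  exact norm_sub_le A B

theorem aux_col {m n : ℕ} (A : Matrix (Fin m) (Fin n) ℝ) (v : Fin n → ℝ) :
    ∑ i, (A *ᵥ v) i ^ 2 ≤ matrixSpectralNorm A ^ 2 * ∑ i, v i ^ 2 := by
  have h := (LinearMap.toContinuousLinearMap (Matrix.toEuclideanLin A)).le_opNorm
    (WithLp.toLp 2 v)
  have h2 := pow_le_pow_left₀ (norm_nonneg _) h 2
  rw [mul_pow, EuclideanSpace.norm_sq_eq, EuclideanSpace.norm_sq_eq] at h2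
  simpa [matrixSpectralNorm, Matrix.toLpLin_toLp] using h2

theorem aux_mul_left {m n p : ℕ} (A : Matrix (Fin m) (Fin n) ℝ) (B : Matrix (Fin n) (Fin p) ℝ) :
    frobeniusNorm (A * B) ≤ matrixSpectralNorm A * frobeniusNorm B := by
  have hs : 0 ≤ matrixSpectralNorm A := norm_nonneg _
  unfold frobeniusNorm
  rw [← Real.sqrt_sq hs, ← Real.sqrt_mul (sq_nonneg _)]
  apply Real.sqrt_le_sqrt
  rw [Finset.sum_comm, Finset.sum_comm (f := fun i j => B i j ^ 2), Finset.mul_sum]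
  exact Finset.sum_le_sum fun j _ => aux_col A (fun i => B i j)

theorem aux_mul_right {m n p : ℕ} (A : Matrix (Fin m) (Fin n) ℝ) (B : Matrix (Fin n) (Fin p) ℝ) :
    frobeniusNorm (A * B) ≤ frobeniusNorm A * matrixSpectralNorm B := by
  rw [← aux_frob_transpose, Matrix.transpose_mul, ← aux_frob_transpose A,
    ← aux_spec_transpose B, mul_comm]
  exact aux_mul_left _ _

theorem Q2R4_residual_bound {m n : ℕ}
    (X Q Q1 Q2 E3 E7 : Matrix (Fin m) (Fin n) ℝ)
    (R R1 R2 R3 R4 E4 E8 : Matrix (Fin n) (Fin n) ℝ)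
    (h1 : Q1 * R1 = Q + E3) (h2 : R1 * R - R2 = E4)
    (h3 : Q2 * R3 = Q1 + E7) (h4 : R3 * R2 - R4 = E8) :
    frobeniusNorm (Q2 * R4 - X) ≤
      frobeniusNorm (Q * R - X) + frobeniusNorm E3 * matrixSpectralNorm R +
        matrixSpectralNorm Q1 * frobeniusNorm E4 +
        frobeniusNorm E7 * matrixSpectralNorm R2 +
        matrixSpectralNorm Q2 * frobeniusNorm E8 := by
  have key : Q2 * R4 - X = (Q * R - X) + E3 * R - Q1 * E4 + E7 * R2 - Q2 * E8 := by
    have e3 : E3 = Q1 * R1 - Q := by rw [h1]; abel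
    have e7 : E7 = Q2 * R3 - Q1 := by rw [h3]; abel
    rw [e3, e7, ← h2, ← h4]
    simp only [Matrix.sub_mul, Matrix.mul_sub, Matrix.mul_assoc]
    abel
  rw [key]
  have a1 := aux_frob_sub ((Q * R - X) + E3 * R - Q1 * E4 + E7 * R2) (Q2 * E8)
  have a2 := aux_frob_add ((Q * R - X) + E3 * R - Q1 * E4) (E7 * R2)
  have a3 := aux_frob_sub ((Q * R - X) + E3 * R) (Q1 * E4)
  have a4 := aux_frob_add (Q * R - X) (E3 * R)
  have b1 := aux_mul_right E3 R
  have b2 := aux_mul_left Q1 E4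
  have b3 := aux_mul_right E7 R2
  have b4 := aux_mul_left Q2 E8
  linarith
end
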